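/- arXiv:1611.10303 — 2 statements merged into one kernel-verified Lean document; each statement's English description precedes it below -/
import Mathlib

section
/- Let n ≥ 2 and let λ = (λ_1, …, λ_r) be a tuple of positive integers with λ_1 + ⋯ + λ_r = n. Then for every permutation σ ∈ S_{n−1}, viewed inside S_n as fixing the last element of Fin n, the number of fixed points of σ acting on X_n(λ) equals the sum over j ∈ Fin r of the number of fixed points of σ acting on X_{n−1}(λ(j)); that is, |{f ∈ X_n(λ) : f ∘ σ⁻¹ = f}| = ∑_{j=1}^{r} |{g ∈ X_{n−1}(λ(j)) : g ∘ σ⁻¹ = g}|. (This is the character-value form of Theorem 4.1, since the total Springer representation TSp(λ) is the permutation character of S_n on X_n(λ).) -/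
open Nat

/-- `XSet n r lam` is the set of functions `f : Fin n → Fin r` such that the fiber
`f⁻¹(j)` has exactly `lam j` elements for every `j`. -/
def XSet (n r : ℕ) (lam : Fin r → ℕ) : Type :=
  {f : Fin n → Fin r // ∀ j : Fin r, (Finset.univ.filter fun i => f i = j).card = lam j}

noncomputable instance (n r : ℕ) (lam : Fin r → ℕ) : Fintype (XSet n r lam) := by
  unfold XSet; infer_instance

/-- The natural inclusion `S_{n-1} ↪ S_n` whose image consists of the permutations of
`Fin n` fixing the last element. -/
def embedPerm (n : ℕ) (σ : Equiv.Perm (Fin (n - 1))) : Equiv.Perm (Fin n) :=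
  σ.viaFintypeEmbedding (Fin.castLEEmb (Nat.sub_le n 1))

/-- `decAt lam j` is the tuple `λ(j) = (λ_1, …, λ_j − 1, …, λ_r)`. -/
def decAt {r : ℕ} (lam : Fin r → ℕ) (j : Fin r) : Fin r → ℕ :=
  Function.update lam j (lam j - 1)

theorem embedPerm_castSucc {m : ℕ} (σ : Equiv.Perm (Fin m)) (i : Fin m) :
    embedPerm (m + 1) σ i.castSucc = (σ i).castSucc :=
  σ.viaFintypeEmbedding_apply_image (Fin.castLEEmb (Nat.sub_le (m + 1) 1)) i

theorem embedPerm_last {m : ℕ} (σ : Equiv.Perm (Fin m)) :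
    embedPerm (m + 1) σ (Fin.last m) = Fin.last m := by
  refine σ.viaFintypeEmbedding_apply_notMem_range (Fin.castLEEmb (Nat.sub_le (m + 1) 1)) ?_
  rintro ⟨i, hi⟩
  exact (Fin.castSucc_lt_last i).ne hi

theorem comp_perm_inv_eq_iff {α β : Type*} (σ : Equiv.Perm α) (f : α → β) :
    f ∘ ⇑σ⁻¹ = f ↔ ∀ i, f (σ i) = f i := by
  rw [funext_iff, σ.surjective.forall]
  simp [eq_comm]

theorem comp_embedPerm_inv_eq_iff {m : ℕ} {β : Type*} (σ : Equiv.Perm (Fin m))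
    (f : Fin (m + 1) → β) :
    f ∘ ⇑(embedPerm (m + 1) σ)⁻¹ = f ↔ (f ∘ Fin.castSucc) ∘ ⇑σ⁻¹ = f ∘ Fin.castSucc := by
  simp only [comp_perm_inv_eq_iff, Fin.forall_fin_succ', embedPerm_castSucc, embedPerm_last,
    Function.comp_apply, and_true]

theorem card_fiber_castSucc {m : ℕ} {β : Type*} [DecidableEq β] (f : Fin (m + 1) → β) (k : β) :
    (Finset.univ.filter fun i => f i = k).card =
      (Finset.univ.filter fun i => (f ∘ Fin.castSucc) i = k).card +
        if f (Fin.last m) = k then 1 else 0 := by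
  simp only [Finset.card_filter, Fin.sum_univ_castSucc, Function.comp_apply]

theorem card_fiber_eq_iff {m r : ℕ} {lam : Fin r → ℕ} (hpos : ∀ j, 0 < lam j)
    (f : Fin (m + 1) → Fin r) :
    (∀ k, (Finset.univ.filter fun i => f i = k).card = lam k) ↔
      ∀ k, (Finset.univ.filter fun i => (f ∘ Fin.castSucc) i = k).card =
        decAt lam (f (Fin.last m)) k := by
  refine forall_congr' fun k => ?_
  rw [card_fiber_castSucc, decAt, Function.update_apply]
  have := hpos k
  grind

/-- Splitting off the value at the last element identifies the points of `XSet (m + 1) r lam`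
fixed by `σ` with the points fixed by `σ` in the sets `XSet m r (decAt lam j)`. -/
def fixedPointsEquivSigma {m r : ℕ} {lam : Fin r → ℕ} (hpos : ∀ j, 0 < lam j)
    (σ : Equiv.Perm (Fin m)) :
    {f : XSet (m + 1) r lam // f.1 ∘ ⇑(embedPerm (m + 1) σ)⁻¹ = f.1} ≃
      Σ j : Fin r, {g : XSet m r (decAt lam j) // g.1 ∘ ⇑σ⁻¹ = g.1} where
  toFun f := ⟨f.1.1 (Fin.last m), ⟨f.1.1 ∘ Fin.castSucc, (card_fiber_eq_iff hpos _).1 f.1.2⟩,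
    (comp_embedPerm_inv_eq_iff σ _).1 f.2⟩
  invFun g := ⟨⟨Fin.snoc (α := fun _ => Fin r) g.2.1.1 g.1, (card_fiber_eq_iff hpos _).2 (by
      simpa [Function.comp_def] using g.2.1.2)⟩,
    (comp_embedPerm_inv_eq_iff σ _).2 (by simpa [Function.comp_def] using g.2.2)⟩
  left_inv f := Subtype.ext <| Subtype.ext <| Fin.snoc_init_self (α := fun _ => Fin r) f.1.1
  right_inv := by
    rintro ⟨j, ⟨g, hg⟩, hfix⟩
    have h₁ : Fin.snoc (α := fun _ => Fin r) g j (Fin.last m) = j := Fin.snoc_last _ _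
    have h₂ : Fin.snoc (α := fun _ => Fin r) g j ∘ Fin.castSucc = g :=
      Fin.init_snoc (α := fun _ => Fin r) _ _
    dsimp only
    generalize_proofs
    generalize Fin.snoc (α := fun _ => Fin r) g j = f at *
    subst h₁ h₂
    rfl

/-- Theorem 4.1 (character-value form): for `σ ∈ S_{n-1} ⊆ S_n`, the number of fixed
points of `σ` on `X_n(λ)` (where `σ • f = f ∘ σ⁻¹`) equals the sum over `j` of the
number of fixed points of `σ` on `X_{n-1}(λ(j))`. -/
theorem card_fixedPoints_eq_sum (n r : ℕ) (hn : 2 ≤ n) (hr : 1 ≤ r) (lam : Fin r → ℕ)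
    (hpos : ∀ j, 0 < lam j) (hsum : ∑ j, lam j = n) (σ : Equiv.Perm (Fin (n - 1))) :
    Fintype.card {f : XSet n r lam // f.1 ∘ ⇑(embedPerm n σ)⁻¹ = f.1} =
      ∑ j : Fin r, Fintype.card {g : XSet (n - 1) r (decAt lam j) // g.1 ∘ ⇑σ⁻¹ = g.1} := by
  obtain ⟨m, rfl⟩ : ∃ m, n = m + 1 := ⟨n - 1, by lia⟩
  rw [← Fintype.card_sigma]
  exact Fintype.card_congr (fixedPointsEquivSigma hpos σ)
end

section
/- Let R be a commutative ring, N ≥ 1 a number of variables, and μ a multiset of positive integers (a partition). Write μ = (1^{r'_1} 2^{r'_2} 3^{r'_3} ⋯), so r'_i is the multiplicity of i in μ. Then in the polynomial ring R[x_1, …, x_N] one has the Pieri-type identity: m_μ · (x_1 + ⋯ + x_N) = ∑_{i ≥ 1, r'_i ≥ 1} (r'_{i+1} + 1) · m_{μ↑i} + (r'_1 + 1) · m_{μ⁺}, where the sum runs over the distinct values i occurring in μ. -/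
open Nat

/-- The multiset of nonzero exponents of a monomial exponent vector `d : Fin N →₀ ℕ`. -/
def expMultiset {N : ℕ} (d : Fin N →₀ ℕ) : Multiset ℕ :=
  (Finset.univ.val.map ⇑d).filter (· ≠ 0)

/-- The monomial symmetric polynomial `m_μ` in `N` variables: the sum of all distinct
monomials whose multiset of nonzero exponents equals `μ` (zero if `μ` has more parts
than `N`).  All such exponent vectors are bounded above by the constant vector `μ.sum`,
so the sum below captures them all. -/
noncomputable def msym (R : Type*) [CommRing R] (N : ℕ) (μ : Multiset ℕ) :
    MvPolynomial (Fin N) R :=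
  ∑ d ∈ (Finset.Iic (Finsupp.equivFunOnFinite.symm fun _ : Fin N => μ.sum)).filter
      (fun d => expMultiset d = μ),
    MvPolynomial.monomial d 1

/-- The multiset of nonzero exponents of `d`, with the contribution of the coordinate `t`
split off. -/
theorem expMultiset_eq_add {N : ℕ} (d : Fin N →₀ ℕ) (t : Fin N) :
    expMultiset d = (if d t = 0 then 0 else {d t}) +
      ((Finset.univ.erase t).val.map ⇑d).filter (· ≠ 0) := by
  have h : (Finset.univ : Finset (Fin N)).val = t ::ₘ (Finset.univ.erase t).val := by
    rw [Finset.erase_val, Multiset.cons_erase (Finset.mem_univ_val t)]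
  rw [expMultiset, h, Multiset.map_cons, Multiset.filter_cons]
  split_ifs <;> simp_all

theorem le_sum_expMultiset {N : ℕ} (d : Fin N →₀ ℕ) (t : Fin N) :
    d t ≤ (expMultiset d).sum := by
  rw [expMultiset_eq_add d t, Multiset.sum_add]
  split_ifs with h <;> simp [h]

theorem sum_ite_eq_count_expMultiset {N : ℕ} (d : Fin N →₀ ℕ) {k : ℕ} (hk : k ≠ 0) :
    (∑ t : Fin N, if d t = k then 1 else 0) = (expMultiset d).count k := by
  rw [expMultiset, Multiset.count_filter_of_pos (p := (· ≠ 0)) hk, Multiset.count_map, ← Finset.card_filter]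
  simp only [eq_comm (a := k)]
  rfl

theorem coeff_msym (R : Type*) [CommRing R] {N : ℕ} (μ : Multiset ℕ) (d : Fin N →₀ ℕ) :
    (msym R N μ).coeff d = if expMultiset d = μ then 1 else 0 := by
  rw [msym, MvPolynomial.coeff_sum]
  simp only [MvPolynomial.coeff_monomial]
  rw [Finset.sum_ite_eq']
  refine if_congr ?_ rfl rfl
  rw [Finset.mem_filter, Finset.mem_Iic, and_iff_right_iff_imp]
  rintro rfl t
  exact le_sum_expMultiset d t

/-- Lowering a nonzero exponent `e t` by one yields exponent multiset `μ` iff the exponent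
multiset of `e` is obtained from `μ` by raising a part to `e t` or adjoining `e t = 1`. -/
theorem expMultiset_tsub_single_eq_iff {N : ℕ} (e : Fin N →₀ ℕ) (t : Fin N) {j : ℕ}
    (hj : e t = j + 1) (μ : Multiset ℕ) :
    expMultiset (e - Finsupp.single t 1) = μ ↔
      if j = 0 then expMultiset e = 1 ::ₘ μ
      else j ∈ μ ∧ expMultiset e = (j + 1) ::ₘ μ.erase j := by
  have h : (Finset.univ.erase t).val.map ⇑(e - Finsupp.single t 1 : Fin N →₀ ℕ) =
      (Finset.univ.erase t).val.map ⇑e := by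
    refine Multiset.map_congr rfl fun s hs => ?_
    have hst : t ≠ s := (Finset.ne_of_mem_erase (Finset.mem_val.mp hs)).symm
    simp [Finsupp.single_eq_of_ne' hst]
  rw [expMultiset_eq_add (e - Finsupp.single t 1) t, expMultiset_eq_add e t, h]
  have ht : (e - Finsupp.single t 1 : Fin N →₀ ℕ) t = j := by simp [hj]
  rw [ht, hj, if_neg j.succ_ne_zero]
  generalize ((Finset.univ.erase t).val.map ⇑e).filter (· ≠ 0) = M
  split_ifs with h0
  · simp [h0]
  · rw [Multiset.singleton_add, Multiset.singleton_add, Multiset.cons_inj_right]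
    constructor
    · rintro rfl
      simp
    · rintro ⟨hm, rfl⟩
      exact Multiset.cons_erase hm

theorem ite_expMultiset_tsub_single {N : ℕ} (e : Fin N →₀ ℕ) (t : Fin N) (μ : Multiset ℕ)
    (hpos : ∀ p ∈ μ, 0 < p) :
    (if t ∈ e.support then if expMultiset (e - Finsupp.single t 1) = μ then 1 else 0 else 0) =
      (∑ i ∈ μ.toFinset, (if e t = i + 1 then 1 else 0) *
          if expMultiset e = (i + 1) ::ₘ μ.erase i then 1 else 0) +
        (if e t = 1 then 1 else 0) * if expMultiset e = 1 ::ₘ μ then 1 else 0 := by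
  simp only [Finsupp.mem_support_iff]
  rcases hj : e t with _ | j
  · simp
  · simp only [expMultiset_tsub_single_eq_iff e t hj, Nat.add_right_cancel_iff, ite_mul, one_mul,
      zero_mul, Finset.sum_ite_eq, Multiset.mem_toFinset]
    rcases eq_or_ne j 0 with rfl | h0
    · have : 0 ∉ μ := fun h => (hpos 0 h).false
      simp [this]
    · simp [h0, ite_and]

/-- The Pieri-type identity
`m_μ · (x_1 + ⋯ + x_N) = ∑_{i ∈ μ} (r'_{i+1} + 1) · m_{μ↑i} + (r'_1 + 1) · m_{μ⁺}`,
where `r'_i` is the multiplicity of `i` in `μ`, `μ↑i` replaces one copy of `i` by `i+1`,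
and `μ⁺` adjoins one extra copy of `1` (Appendix A of the paper). -/
theorem msym_mul_sum_X (R : Type*) [CommRing R] (N : ℕ) (hN : 1 ≤ N) (μ : Multiset ℕ)
    (hpos : ∀ p ∈ μ, 0 < p) :
    msym R N μ * (∑ t : Fin N, MvPolynomial.X t) =
      (∑ i ∈ μ.toFinset, (μ.count (i + 1) + 1) • msym R N ((i + 1) ::ₘ μ.erase i)) +
        (μ.count 1 + 1) • msym R N (1 ::ₘ μ) := by
  ext e
  have key (k : ℕ) (hk : k ≠ 0) (ν : Multiset ℕ) :
      (∑ t : Fin N, (if e t = k then (1 : ℕ) else 0) * if expMultiset e = k ::ₘ ν then 1 else 0) =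
        (ν.count k + 1) * if expMultiset e = k ::ₘ ν then 1 else 0 := by
    rw [← Finset.sum_mul, sum_ite_eq_count_expMultiset e hk]
    split_ifs with h
    · rw [h, Multiset.count_cons_self]
    · simp
  have main : (∑ t : Fin N, if t ∈ e.support then
        if expMultiset (e - Finsupp.single t 1) = μ then 1 else 0 else 0) =
      (∑ i ∈ μ.toFinset, (μ.count (i + 1) + 1) *
          if expMultiset e = (i + 1) ::ₘ μ.erase i then 1 else 0) +
        (μ.count 1 + 1) * if expMultiset e = 1 ::ₘ μ then 1 else 0 := by
    simp_rw [ite_expMultiset_tsub_single e _ μ hpos]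
    rw [Finset.sum_add_distrib, Finset.sum_comm, key 1 one_ne_zero]
    congr 1
    refine Finset.sum_congr rfl fun i _ => ?_
    rw [key (i + 1) i.succ_ne_zero, Multiset.count_erase_of_ne i.succ_ne_self]
  simp only [Finset.mul_sum, MvPolynomial.coeff_sum, MvPolynomial.coeff_add,
    MvPolynomial.coeff_smul, MvPolynomial.coeff_mul_X', coeff_msym]
  simp only [nsmul_eq_mul]
  exact_mod_cast congrArg (Nat.cast : ℕ → R) main
end
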